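/- arXiv:1606.09494 — 2 statements merged into one kernel-verified Lean document; each statement's English description precedes it below -/
import Mathlib

section
/- Let W be a channel on a finite set X whose directed graph G(W) is cycle-reverter. On the set P of 2-element subsets of X define v ≤ w to mean v = w or there is a directed path from v to w in G_1(W), and define c(v) to be the connected component of v in the undirected graph G_0(W). Then ≤ is a partial order on P, c(v) ≠ c(w) whenever v < w, and every colored cycle in (P, ≤, c) is monochromatic; that is, (P, c) is a colored poset. -/
/-- A (discrete memoryless) channel on a finite alphabet `X`:
`Pr x y` is the probability of receiving `x` when `y` was sent. -/
def IsChannel {X : Type*} [Fintype X] (Pr : X → X → ℝ) : Prop :=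
  (∀ x y : X, 0 ≤ Pr x y) ∧ ∀ y : X, ∑ x : X, Pr x y = 1

/-- The edge relation of the directed graph `G(W)`: edge from `{x,y}` to `{x,z}`
whenever `y ≠ z` and `Pr(x|y) ≤ Pr(x|z)`. -/
def GEdge {X : Type*} [DecidableEq X] (Pr : X → X → ℝ) (v w : Finset X) : Prop :=
  ∃ x y z : X, x ≠ y ∧ x ≠ z ∧ y ≠ z ∧ v = {x, y} ∧ w = {x, z} ∧ Pr x y ≤ Pr x z

/-- The edge relation of the directed graph `G₁(W)`: edge from `{x,y}` to `{x,z}`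
whenever `y ≠ z` and `Pr(x|y) < Pr(x|z)`. -/
def G1Edge {X : Type*} [DecidableEq X] (Pr : X → X → ℝ) (v w : Finset X) : Prop :=
  ∃ x y z : X, x ≠ y ∧ x ≠ z ∧ y ≠ z ∧ v = {x, y} ∧ w = {x, z} ∧ Pr x y < Pr x z

/-- The adjacency relation of the (undirected) graph `G₀(W)`: `{x,y}` and `{x,z}`
are joined whenever `y ≠ z` and `Pr(x|y) = Pr(x|z)`. -/
def G0Adj {X : Type*} [DecidableEq X] (Pr : X → X → ℝ) (v w : Finset X) : Prop :=
  ∃ x y z : X, x ≠ y ∧ x ≠ z ∧ y ≠ z ∧ v = {x, y} ∧ w = {x, z} ∧ Pr x y = Pr x z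

/-- A directed graph (given by its edge relation `E`) is cycle-reverter if for every
directed closed walk `v 0 → v 1 → ⋯ → v (r-1) → v 0`, all reversed edges are also
edges of the graph. -/
def CycleReverter {V : Type*} (E : V → V → Prop) : Prop :=
  ∀ r : ℕ, 0 < r → ∀ v : ℕ → V,
    (∀ i < r, E (v i) (v ((i + 1) % r))) → ∀ i < r, E (v ((i + 1) % r)) (v i)

theorem Relation.ReflTransGen.exists_nat_path {V : Type*} {E : V → V → Prop} {a b : V}
    (h : Relation.ReflTransGen E a b) :
    ∃ (n : ℕ) (f : ℕ → V), f 0 = a ∧ f n = b ∧ ∀ i < n, E (f i) (f (i + 1)) := by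
  induction h using Relation.ReflTransGen.head_induction_on with
  | refl => exact ⟨0, fun _ => b, rfl, rfl, by simp⟩
  | @head a c hac _ ih =>
    obtain ⟨n, f, h0, hn, hf⟩ := ih
    refine ⟨n + 1, fun i => Nat.casesOn i a f, rfl, hn, ?_⟩
    rintro (_ | i) hi
    · simpa [h0] using hac
    · exact hf i (by omega)

theorem CycleReverter.reverse_of_reflTransGen {V : Type*} {E : V → V → Prop}
    (hE : CycleReverter E) {a b : V} (hab : E a b) (hba : Relation.ReflTransGen E b a) :
    E b a := by
  obtain ⟨n, f, h0, hn, hf⟩ := hba.exists_nat_path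
  have hcycle : ∀ i < n + 1, E (f i) (f ((i + 1) % (n + 1))) := by
    intro i hi
    rcases Nat.lt_succ_iff_lt_or_eq.mp hi with hlt | rfl
    · rw [Nat.mod_eq_of_lt (by omega)]
      exact hf i hlt
    · rw [Nat.mod_self, h0, hn]
      exact hab
  have hrev := hE (n + 1) n.succ_pos f hcycle n n.lt_succ_self
  rwa [Nat.mod_self, h0, hn] at hrev

theorem G1Edge.gEdge {X : Type*} [DecidableEq X] {Pr : X → X → ℝ} {v w : Finset X}
    (h : G1Edge Pr v w) : GEdge Pr v w := by
  obtain ⟨x, y, z, hxy, hxz, hyz, hv, hw, hlt⟩ := h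
  exact ⟨x, y, z, hxy, hxz, hyz, hv, hw, hlt.le⟩

theorem G0Adj.gEdge {X : Type*} [DecidableEq X] {Pr : X → X → ℝ} {v w : Finset X}
    (h : G0Adj Pr v w) : GEdge Pr v w := by
  obtain ⟨x, y, z, hxy, hxz, hyz, hv, hw, heq⟩ := h
  exact ⟨x, y, z, hxy, hxz, hyz, hv, hw, heq.le⟩

theorem G0Adj.symm {X : Type*} [DecidableEq X] {Pr : X → X → ℝ} {v w : Finset X}
    (h : G0Adj Pr v w) : G0Adj Pr w v := by
  obtain ⟨x, y, z, hxy, hxz, hyz, hv, hw, heq⟩ := h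
  exact ⟨x, z, y, hxz, hxy, hyz.symm, hw, hv, heq.symm⟩

theorem GEdge.le_of_pair {X : Type*} [DecidableEq X] {Pr : X → X → ℝ} {x y z : X}
    (hxy : x ≠ y) (hxz : x ≠ z) (hyz : y ≠ z) (h : GEdge Pr {x, z} {x, y}) :
    Pr x z ≤ Pr x y := by
  obtain ⟨a, b, c, hab, hac, hbc, hv, hw, hle⟩ := h
  have hax : a = x := by
    have hz : a ∈ ({x, z} : Finset X) := by simp [hv]
    have hy : a ∈ ({x, y} : Finset X) := by simp [hw]
    simp only [Finset.mem_insert, Finset.mem_singleton] at hz hy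
    grind
  subst hax
  have hb : b ∈ ({a, z} : Finset X) := by simp [hv]
  have hc : c ∈ ({a, y} : Finset X) := by simp [hw]
  simp only [Finset.mem_insert, Finset.mem_singleton] at hb hc
  grind

theorem G1Edge.not_gEdge_symm {X : Type*} [DecidableEq X] {Pr : X → X → ℝ} {v w : Finset X}
    (h : G1Edge Pr v w) : ¬ GEdge Pr w v := by
  obtain ⟨x, y, z, hxy, hxz, hyz, rfl, rfl, hlt⟩ := h
  exact fun hrev => hlt.not_ge (hrev.le_of_pair hxy hxz hyz)

theorem GEdge.g0Adj_of_symm {X : Type*} [DecidableEq X] {Pr : X → X → ℝ} {v w : Finset X}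
    (h : GEdge Pr v w) (hrev : GEdge Pr w v) : G0Adj Pr v w := by
  obtain ⟨x, y, z, hxy, hxz, hyz, rfl, rfl, hle⟩ := h
  exact ⟨x, y, z, hxy, hxz, hyz, rfl, rfl, hle.antisymm (hrev.le_of_pair hxy hxz hyz)⟩

theorem CycleReverter.reflTransGen_g0Adj {X : Type*} [DecidableEq X] {Pr : X → X → ℝ}
    (hcr : CycleReverter (GEdge Pr)) {v w : Finset X}
    (hvw : Relation.ReflTransGen (GEdge Pr) v w) (hwv : Relation.ReflTransGen (GEdge Pr) w v) :
    Relation.ReflTransGen (G0Adj Pr) v w := by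
  induction hvw with
  | refl => exact .refl
  | tail hvb hbc ih =>
    exact (ih (hwv.head hbc)).tail
      (hbc.g0Adj_of_symm (hcr.reverse_of_reflTransGen hbc (hwv.trans hvb)))

theorem CycleReverter.eq_of_reflTransGen_g1Edge {X : Type*} [DecidableEq X] {Pr : X → X → ℝ}
    (hcr : CycleReverter (GEdge Pr)) {v w : Finset X}
    (hvw : Relation.ReflTransGen (G1Edge Pr) v w)
    (hwv : Relation.ReflTransGen (GEdge Pr) w v) : v = w := by
  rcases hvw.cases_head with h | ⟨u, hvu, huw⟩
  · exact h
  · have huv := (Relation.ReflTransGen.mono (fun _ _ => G1Edge.gEdge) _ _ huw).trans hwv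
    exact absurd (hcr.reverse_of_reflTransGen hvu.gEdge huv) hvu.not_gEdge_symm

/-- Let `W` be a channel whose graph `G(W)` is cycle-reverter. On the set of
2-element subsets of `X`, define `v ≤ w` iff `v = w` or there is a directed path
from `v` to `w` in `G₁(W)` (i.e. `Relation.ReflTransGen (G1Edge Pr) v w`), and
let `c(v)` be the connected component of `v` in `G₀(W)` (so `c v = c w` iff
`Relation.ReflTransGen (G0Adj Pr) v w`).  Then `≤` is a partial order
(reflexive, transitive, antisymmetric), `c` is a coloration (`v < w` implies
`c v ≠ c w`), and every colored cycle is monochromatic; that is, `(P, c)` is a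
colored poset. -/
theorem stmt8 {X : Type*} [Fintype X] [DecidableEq X] (Pr : X → X → ℝ)
    (hch : IsChannel Pr) (hcr : CycleReverter (GEdge Pr)) :
    -- `≤` is reflexive
    (∀ v : Finset X, Relation.ReflTransGen (G1Edge Pr) v v) ∧
    -- `≤` is transitive
    (∀ u v w : Finset X, Relation.ReflTransGen (G1Edge Pr) u v →
      Relation.ReflTransGen (G1Edge Pr) v w → Relation.ReflTransGen (G1Edge Pr) u w) ∧
    -- `≤` is antisymmetric
    (∀ v w : Finset X, v.card = 2 → w.card = 2 →
      Relation.ReflTransGen (G1Edge Pr) v w → Relation.ReflTransGen (G1Edge Pr) w v →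
      v = w) ∧
    -- `c` is a coloration: `v < w` implies `c v ≠ c w`
    (∀ v w : Finset X, v.card = 2 → w.card = 2 →
      Relation.ReflTransGen (G1Edge Pr) v w → v ≠ w →
      ¬ Relation.ReflTransGen (G0Adj Pr) v w) ∧
    -- every colored cycle is monochromatic
    (∀ r : ℕ, ∀ x : ℕ → Finset X, (∀ i ≤ r, (x i).card = 2) → x r = x 0 →
      (∀ i < r, ¬ Relation.ReflTransGen (G0Adj Pr) (x i) (x (i + 1)) →
        Relation.ReflTransGen (G1Edge Pr) (x i) (x (i + 1)) ∧ x i ≠ x (i + 1)) →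
      ∀ i ≤ r, Relation.ReflTransGen (G0Adj Pr) (x i) (x 0)) := by
  refine ⟨fun v => .refl, fun u v w => .trans, ?_, ?_, ?_⟩
  · intro v w _ _ hvw hwv
    exact hcr.eq_of_reflTransGen_g1Edge hvw (Relation.ReflTransGen.mono (fun _ _ => G1Edge.gEdge) _ _ hwv)
  · intro v w _ _ hvw hne h0
    have hwv : Relation.ReflTransGen (GEdge Pr) w v :=
      Relation.ReflTransGen.mono (fun _ _ (h : G0Adj Pr _ _) => h.symm.gEdge) _ _ h0.swap
    exact hne (hcr.eq_of_reflTransGen_g1Edge hvw hwv)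
  · intro r x _ hclosed hstep i hi
    have hG : ∀ j < r, Relation.ReflTransGen (GEdge Pr) (x j) (x (j + 1)) := by
      intro j hj
      by_cases h0 : Relation.ReflTransGen (G0Adj Pr) (x j) (x (j + 1))
      · exact Relation.ReflTransGen.mono (fun _ _ => G0Adj.gEdge) _ _ h0
      · exact Relation.ReflTransGen.mono (fun _ _ => G1Edge.gEdge) _ _ (hstep j hj h0).1
    have hpath : ∀ j k, j ≤ k → k ≤ r → Relation.ReflTransGen (GEdge Pr) (x j) (x k) := by
      intro j k hjk
      induction k, hjk using Nat.le_induction with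
      | base => exact fun _ => .refl
      | succ k _ ih => exact fun hk => (ih (by omega)).trans (hG k (by omega))
    exact hcr.reflTransGen_g0Adj (hclosed ▸ hpath i r hi le_rfl) (hpath 0 i i.zero_le hi)
end

section
/- Let p, q ∈ (0,1), n ≥ 1, r ≥ 1, and let x_0, x_1, …, x_{r−1} ∈ (ℤ/2ℤ)^n (indices taken modulo r). If, for the channel BAC^n(p,q), Pr(x_i|x_{i−1}) ≤ Pr(x_i|x_{i+1}) holds for every i with 0 ≤ i < r, then Pr(x_i|x_{i−1}) = Pr(x_i|x_{i+1}) for every i with 0 ≤ i < r. -/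
/-- Single-use binary asymmetric channel: `bacPr1 p q x y` is the probability of
receiving `x` when `y` was sent, with `Pr(1|0) = p`, `Pr(0|0) = 1-p`,
`Pr(0|1) = q`, `Pr(1|1) = 1-q`. -/
def bacPr1 (p q : ℝ) (x y : ZMod 2) : ℝ :=
  if y = 0 then (if x = 0 then 1 - p else p) else (if x = 0 then q else 1 - q)

/-- The `n`-fold binary asymmetric channel `BAC^n(p,q)` on `(ℤ/2ℤ)^n`. -/
def bacPr (p q : ℝ) (n : ℕ) (x y : Fin n → ZMod 2) : ℝ :=
  ∏ i : Fin n, bacPr1 p q (x i) (y i)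

lemma bacPr1_pos {p q : ℝ} (hp : p ∈ Set.Ioo (0 : ℝ) 1) (hq : q ∈ Set.Ioo (0 : ℝ) 1)
    (x y : ZMod 2) : 0 < bacPr1 p q x y := by
  obtain ⟨hp0, hp1⟩ := hp
  obtain ⟨hq0, hq1⟩ := hq
  unfold bacPr1
  split_ifs <;> linarith

/-- The unnormalized stationary weight for which the binary asymmetric channel is reversible. -/
def bacWeight (p q : ℝ) (n : ℕ) (x : Fin n → ZMod 2) : ℝ :=
  ∏ i, if x i = 0 then q else p

lemma bacPr_pos {p q : ℝ} (hp : p ∈ Set.Ioo (0 : ℝ) 1) (hq : q ∈ Set.Ioo (0 : ℝ) 1)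
    {n : ℕ} (x y : Fin n → ZMod 2) : 0 < bacPr p q n x y :=
  Finset.prod_pos fun _ _ => bacPr1_pos hp hq _ _

lemma bacWeight_pos {p q : ℝ} (hp : 0 < p) (hq : 0 < q) {n : ℕ} (x : Fin n → ZMod 2) :
    0 < bacWeight p q n x :=
  Finset.prod_pos fun _ _ => by split_ifs <;> assumption

/-- Detailed balance for the binary asymmetric channel. -/
lemma bacWeight_mul_bacPr (p q : ℝ) (n : ℕ) (x y : Fin n → ZMod 2) :
    bacWeight p q n y * bacPr p q n x y = bacWeight p q n x * bacPr p q n y x := by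
  simp only [bacWeight, bacPr, ← Finset.prod_mul_distrib]
  refine Finset.prod_congr rfl fun i _ => ?_
  unfold bacPr1
  split_ifs <;> ring

/-- Kolmogorov's criterion: for a kernel in detailed balance with a positive weight, inequalities
between the backward and forward transitions along a permutation are all equalities. -/
lemma eq_of_le_of_detailed_balance {α ι : Type*} [Fintype ι] {P : α → α → ℝ} {w : α → ℝ}
    (hP : ∀ a b, 0 < P a b) (hw : ∀ a, 0 < w a) (hPw : ∀ a b, w b * P a b = w a * P b a)
    (σ : Equiv.Perm ι) (x : ι → α)
    (h : ∀ i, P (x i) (x (σ.symm i)) ≤ P (x i) (x (σ i))) (i : ι) :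
    P (x i) (x (σ.symm i)) = P (x i) (x (σ i)) := by
  have hprod : ∏ i, P (x i) (x (σ.symm i)) = ∏ i, P (x i) (x (σ i)) := by
    have hb : ∏ i, w (x (σ i)) * P (x i) (x (σ i)) = ∏ i, w (x i) * P (x (σ i)) (x i) :=
      Finset.prod_congr rfl fun i _ => hPw _ _
    rw [Finset.prod_mul_distrib, Finset.prod_mul_distrib,
      Equiv.prod_comp σ fun i => w (x i)] at hb
    rw [← Equiv.prod_comp σ fun i => P (x i) (x (σ.symm i))]
    simpa using (mul_left_cancel₀ (Finset.prod_pos fun i _ => hw (x i)).ne' hb).symm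
  by_contra hne
  exact (Finset.prod_lt_prod (fun i _ => hP _ _) (fun i _ => h i)
    ⟨i, Finset.mem_univ i, lt_of_le_of_ne (h i) hne⟩).ne hprod

/-- For `p, q ∈ (0,1)`, `n ≥ 1`, `r ≥ 1` and `x 0, …, x (r-1) ∈ (ℤ/2ℤ)^n`
(indices mod `r`): if `Pr(x_i|x_{i-1}) ≤ Pr(x_i|x_{i+1})` for every `i < r`,
then `Pr(x_i|x_{i-1}) = Pr(x_i|x_{i+1})` for every `i < r`. -/
theorem stmt12 (p q : ℝ) (hp : p ∈ Set.Ioo (0 : ℝ) 1) (hq : q ∈ Set.Ioo (0 : ℝ) 1)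
    (n : ℕ) (hn : 1 ≤ n) (r : ℕ) (hr : 1 ≤ r) (x : ℕ → Fin n → ZMod 2)
    (h : ∀ i < r, bacPr p q n (x i) (x ((i + r - 1) % r)) ≤
      bacPr p q n (x i) (x ((i + 1) % r))) :
    ∀ i < r, bacPr p q n (x i) (x ((i + r - 1) % r)) =
      bacPr p q n (x i) (x ((i + 1) % r)) := by
  have : NeZero r := ⟨by omega⟩
  have hsucc (i : Fin r) : (Equiv.addRight (1 : Fin r) i : ℕ) = (i + 1) % r := by
    simp [Fin.val_add]
  have hpred (i : Fin r) : ((Equiv.addRight (1 : Fin r)).symm i : ℕ) = (i + r - 1) % r := by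
    obtain rfl | hr1 : r = 1 ∨ 1 < r := by omega
    · omega
    · have hi : (i : ℕ) + r - 1 = r - 1 + i := by omega
      simp [← sub_eq_add_neg, Fin.val_sub, Nat.mod_eq_of_lt hr1, hi]
  intro i hi
  have key := eq_of_le_of_detailed_balance (bacPr_pos hp hq) (bacWeight_pos hp.1 hq.1)
    (bacWeight_mul_bacPr p q n) (Equiv.addRight (1 : Fin r)) (fun i => x i)
    (fun i => by simpa only [hsucc, hpred] using h i i.isLt) ⟨i, hi⟩
  simpa only [hsucc, hpred] using key
end
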